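/- arXiv:1411.7041 — 11 statements merged into one kernel-verified Lean document; each statement's English description precedes it below -/
import Mathlib

section
/- Let E and Ē be nonempty finite index types, let |ĩ⟩ : Fin K → (E × Ē → ℂ) be an orthonormal family spanning a code subspace of the tensor product Hilbert space, and let O be a linear operator on (E × Ē → ℂ) that acts within the code subspace with logical matrix L (i.e. O|ĩ⟩ = Σ_j L_{ji}|j̃⟩ and Oᴴ|ĩ⟩ = Σ_j conj(L_{ij})|j̃⟩ for all i). Then the following are equivalent: (1) there exists an operator O_Ē on (Ē → ℂ) such that (I_E ⊗ O_Ē)|ψ̃⟩ = O|ψ̃⟩ and (I_E ⊗ O_Ē)ᴴ|ψ̃⟩ = Oᴴ|ψ̃⟩ for every vector ψ̃ in the code subspace; (2) for every linear operator X_E on (E → ℂ) and all i, j in Fin K, ⟨ĩ| [O, X_E ⊗ I_Ē] |j̃⟩ = 0. -/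
open scoped ComplexConjugate Matrix

/-- Inner product `⟨v,w⟩ = Σ conj(v)·w` on a finite-dimensional Hilbert space
modeled as functions to `ℂ`. -/
noncomputable def ip {ι : Type*} [Fintype ι] (v w : ι → ℂ) : ℂ :=
  ∑ x, conj (v x) * w x

/-- The action of an operator `X` on the `E` factor of the tensor product,
i.e. `X ⊗ I_Ebar`. -/
noncomputable def actE {E Ebar : Type*} [Fintype E] (X : Matrix E E ℂ)
    (v : E × Ebar → ℂ) : E × Ebar → ℂ :=
  fun p => ∑ m', X p.1 m' * v (m', p.2)

/-- The action of an operator `Y` on the `Ebar` factor of the tensor product,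
i.e. `I_E ⊗ Y`. -/
noncomputable def actEbar {E Ebar : Type*} [Fintype Ebar] (Y : Matrix Ebar Ebar ℂ)
    (v : E × Ebar → ℂ) : E × Ebar → ℂ :=
  fun p => ∑ a', Y p.2 a' * v (p.1, a')

theorem ip_eq {ι : Type*} [Fintype ι] (v w : ι → ℂ) : ip v w = star v ⬝ᵥ w := rfl

theorem ip_adj {ι : Type*} [Fintype ι] (O : Matrix ι ι ℂ) (v w : ι → ℂ) :
    ip v (O.mulVec w) = ip ((Oᴴ).mulVec v) w := by
  rw [ip_eq, ip_eq, Matrix.star_mulVec, Matrix.conjTranspose_conjTranspose,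
    Matrix.dotProduct_mulVec]

theorem ip_actEbar {E Ebar : Type*} [Fintype E] [Fintype Ebar] (Y : Matrix Ebar Ebar ℂ)
    (v w : E × Ebar → ℂ) : ip v (actEbar Y w) = ip (actEbar Yᴴ v) w := by
  simp only [ip, actEbar, Fintype.sum_prod_type, Finset.mul_sum, map_sum, Finset.sum_mul,
    map_mul, Matrix.conjTranspose_apply]
  refine Finset.sum_congr rfl fun m _ => ?_
  rw [Finset.sum_comm]
  refine Finset.sum_congr rfl fun a _ => Finset.sum_congr rfl fun b _ => ?_
  simp
  ring

theorem act_comm {E Ebar : Type*} [Fintype E] [Fintype Ebar] (X : Matrix E E ℂ)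
    (Y : Matrix Ebar Ebar ℂ) (v : E × Ebar → ℂ) :
    actEbar Y (actE X v) = actE X (actEbar Y v) := by
  funext p
  simp only [actE, actEbar, Finset.mul_sum]
  rw [Finset.sum_comm]
  refine Finset.sum_congr rfl fun a _ => Finset.sum_congr rfl fun b _ => ?_
  ring

theorem ip_single {E Ebar : Type*} [Fintype E] [Fintype Ebar] [DecidableEq E] (m n : E)
    (v w : E × Ebar → ℂ) :
    ip v (actE (Matrix.single m n 1) w) = ∑ a, conj (v (m, a)) * w (n, a) := by
  simp only [ip, actE, Fintype.sum_prod_type]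
  rw [Finset.sum_eq_single m]
  · refine Finset.sum_congr rfl fun a _ => ?_
    rw [Finset.sum_eq_single n]
    · simp
    · intro b _ hb
      simp [Matrix.single, hb.symm]
    · simp
  · intro b _ hb
    simp [Matrix.single, hb.symm]
  · simp

open scoped ComplexOrder in
theorem exists_pinv {α β : Type*} [Fintype α] [Fintype β] (V : Matrix α β ℂ) :
    ∃ G : Matrix β α ℂ, Vᴴ * V * G = Vᴴ := by
  classical
  have hle : LinearMap.range (Vᴴ * V).mulVecLin ≤ LinearMap.range (Vᴴ).mulVecLin := by
    rw [Matrix.mulVecLin_mul]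
    exact LinearMap.range_comp_le_range _ _
  have heq := Submodule.eq_of_le_of_finrank_eq hle (by
    change (Vᴴ * V).rank = (Vᴴ).rank
    rw [Matrix.rank_conjTranspose_mul_self, Matrix.rank_conjTranspose])
  have hx : ∀ a : α, ∃ g : β → ℂ, (Vᴴ * V).mulVec g = (Vᴴ).mulVec (Pi.single a 1) := by
    intro a
    have : (Vᴴ).mulVecLin (Pi.single a 1) ∈ LinearMap.range (Vᴴ * V).mulVecLin := by
      rw [heq]; exact ⟨_, rfl⟩
    exact this
  choose g hg using hx
  refine ⟨Matrix.of fun b a => g a b, ?_⟩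
  ext b a
  have := congrFun (hg a) b
  rw [Matrix.mulVec_single_one] at this
  exact this

open scoped ComplexOrder in
theorem exists_implement {α β : Type*} [Fintype α] [Fintype β] (V : Matrix α β ℂ)
    (A B : Matrix β β ℂ) (h : (V * B)ᴴ * V = Vᴴ * (V * A)) :
    ∃ Y : Matrix α α ℂ, Y * V = V * A ∧ Yᴴ * V = V * B := by
  obtain ⟨G, hG⟩ := exists_pinv V
  have cancel : ∀ M N : Matrix β β ℂ, Vᴴ * (V * M) = Vᴴ * (V * N) → V * M = V * N := by
    intro M N hMN
    rw [← sub_eq_zero, ← Matrix.mul_sub]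
    rw [← Matrix.conjTranspose_mul_self_mul_eq_zero, Matrix.mul_assoc, Matrix.mul_sub,
      Matrix.mul_sub, hMN, sub_self]
  have hGV : V * (G * V) = V := by
    classical
    have h1 := cancel (G * V) 1 (by
      rw [← Matrix.mul_assoc, ← Matrix.mul_assoc, hG, Matrix.mul_one])
    rwa [Matrix.mul_one] at h1
  have hherm : (V * G)ᴴ = V * G := by
    have h1 : (V * G)ᴴ * (V * G) = (V * G)ᴴ := by
      rw [Matrix.conjTranspose_mul, Matrix.mul_assoc, ← Matrix.mul_assoc Vᴴ, hG]
    have h2 := congrArg Matrix.conjTranspose h1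
    rw [Matrix.conjTranspose_mul, Matrix.conjTranspose_conjTranspose] at h2
    rw [← h1, h2]
  refine ⟨V * A * G, ?_, ?_⟩
  · have := cancel (A * (G * V)) A (by
      rw [← h, ← Matrix.mul_assoc V, ← Matrix.mul_assoc, ← h, Matrix.mul_assoc, hGV])
    rw [Matrix.mul_assoc, Matrix.mul_assoc, this]
  · have h' : (V * A)ᴴ * V = Vᴴ * (V * B) := by
      have := congrArg Matrix.conjTranspose h
      simpa [Matrix.conjTranspose_mul, Matrix.mul_assoc] using this.symm
    rw [Matrix.conjTranspose_mul, Matrix.mul_assoc, h', ← Matrix.mul_assoc,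
      ← Matrix.conjTranspose_mul, hherm, ← Matrix.mul_assoc, Matrix.mul_assoc V, hGV]

/-- **Operator algebra quantum error correction** (Beny–Kempf–Kribs, as in
Almheiri–Dong–Harlow appendix B): for an operator `O` acting within the code
subspace spanned by an orthonormal family `ti` with logical matrix `L`, there
is an operator `O_Ebar` on `Ebar` implementing `O` (and `Oᴴ`) on the code subspace
iff `O` commutes with the projection of every operator `X_E` on `E` onto the
code subspace. -/
theorem operator_algebra_qec_iff {E Ebar : Type*} [Fintype E] [Fintype Ebar]
    [Nonempty E] [Nonempty Ebar] {K : ℕ}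
    (ti : Fin K → (E × Ebar → ℂ))
    (horth : ∀ i j, ip (ti i) (ti j) = if i = j then 1 else 0)
    (O : Matrix (E × Ebar) (E × Ebar) ℂ) (L : Matrix (Fin K) (Fin K) ℂ)
    (hO : ∀ i, O.mulVec (ti i) = ∑ j, L j i • ti j)
    (hOd : ∀ i, (Oᴴ).mulVec (ti i) = ∑ j, conj (L i j) • ti j) :
    (∃ OEb : Matrix Ebar Ebar ℂ,
        ∀ ψ ∈ Submodule.span ℂ (Set.range ti),
          actEbar OEb ψ = O.mulVec ψ ∧ actEbar OEbᴴ ψ = (Oᴴ).mulVec ψ) ↔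
      ∀ (X : Matrix E E ℂ) (i j : Fin K),
        ip (ti i) (O.mulVec (actE X (ti j))) -
            ip (ti i) (actE X (O.mulVec (ti j))) = 0 := by
  classical
  constructor
  · rintro ⟨Y, hY⟩ X i j
    have hi := hY _ (Submodule.subset_span (Set.mem_range_self i))
    have hj := hY _ (Submodule.subset_span (Set.mem_range_self j))
    rw [ip_adj, ← hi.2, ← ip_actEbar, act_comm, hj.1, sub_self]
  · intro h
    let V : Matrix Ebar (Fin K × E) ℂ := fun a s => ti s.1 (s.2, a)
    let A : Matrix (Fin K × E) (Fin K × E) ℂ := fun s t => if s.2 = t.2 then L s.1 t.1 else 0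
    let B : Matrix (Fin K × E) (Fin K × E) ℂ :=
      fun s t => if s.2 = t.2 then conj (L t.1 s.1) else 0
    have hA : ∀ a i m, (V * A) a (i, m) = O.mulVec (ti i) (m, a) := by
      intro a i m
      rw [hO]
      rw [Matrix.mul_apply]
      simp [V, A, Fintype.sum_prod_type, mul_comm]
    have hB : ∀ a i m, (V * B) a (i, m) = (Oᴴ).mulVec (ti i) (m, a) := by
      intro a i m
      rw [hOd]
      rw [Matrix.mul_apply]
      simp [V, B, Fintype.sum_prod_type, mul_comm]
    obtain ⟨Y, h1, h2⟩ := exists_implement V A B (by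
      ext ⟨i, m⟩ ⟨j, n⟩
      have h0 := h (Matrix.single m n 1) i j
      rw [ip_adj, ip_single, ip_single, sub_eq_zero] at h0
      rw [Matrix.mul_apply, Matrix.mul_apply]
      simp only [Matrix.conjTranspose_apply, hA, hB]
      exact h0)
    refine ⟨Y, fun ψ hψ => ?_⟩
    induction hψ using Submodule.span_induction with
    | mem x hx =>
      obtain ⟨i, rfl⟩ := hx
      constructor
      · funext p
        rw [← hA p.2 i p.1, ← h1]; rfl
      · funext p
        rw [← hB p.2 i p.1, ← h2]; rfl
    | zero => constructor <;> (funext p; simp [actEbar])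
    | add x y _ _ hx hy =>
      rw [Matrix.mulVec_add, Matrix.mulVec_add, ← hx.1, ← hx.2, ← hy.1, ← hy.2]
      constructor <;> (funext p; simp [actEbar, mul_add, Finset.sum_add_distrib])
    | smul c x _ hx =>
      rw [Matrix.mulVec_smul, Matrix.mulVec_smul, ← hx.1, ← hx.2]
      constructor <;> (funext p; simp [actEbar, Finset.mul_sum, mul_left_comm])
end

section
/- Let C : Matrix A B ℂ with A, B finite types, let g := C * Cᴴ, and let M : Matrix B B ℂ. Assume g is invertible and that Cᴴ * C * M = M * (Cᴴ * C). Then the matrix O := C * M * Cᴴ * g⁻¹ satisfies O * C = C * M, and its conjugate transpose satisfies Oᴴ = C * Mᴴ * Cᴴ * g⁻¹ (hence also Oᴴ * C = C * Mᴴ). -/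
open scoped Matrix

theorem recon_aux {A B : Type*} [Fintype A] [Fintype B]
    [DecidableEq A] [DecidableEq B]
    (C : Matrix A B ℂ) (M : Matrix B B ℂ) (h : Matrix A A ℂ)
    (h1 : C * Cᴴ * h = 1) (h2 : h * (C * Cᴴ) = 1)
    (hcomm : Cᴴ * C * M = M * (Cᴴ * C)) :
    (C * M * Cᴴ * h) * C = C * M ∧ h * (C * M * Cᴴ) = C * M * Cᴴ * h := by
  have key : (C * Cᴴ) * (C * M) = C * M * (Cᴴ * C) := by
    calc (C * Cᴴ) * (C * M) = C * (Cᴴ * C * M) := by simp only [Matrix.mul_assoc]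
      _ = _ := by rw [hcomm]; simp only [Matrix.mul_assoc]
  have key2 : C * M = h * (C * M * (Cᴴ * C)) := by
    rw [← key, ← Matrix.mul_assoc, h2, Matrix.one_mul]
  have e : h * (C * M * Cᴴ) = C * M * Cᴴ * h := by
    calc h * (C * M * Cᴴ) = h * (C * M * Cᴴ) * (C * Cᴴ * h) := by rw [h1, Matrix.mul_one]
      _ = h * (C * M * (Cᴴ * C)) * Cᴴ * h := by simp only [Matrix.mul_assoc]
      _ = _ := by rw [← key2]
  refine ⟨?_, e⟩
  rw [← e]
  conv_rhs => rw [key2]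
  simp only [Matrix.mul_assoc]

/-- The explicit construction of the reconstructed operator in the proof of the
operator algebra quantum error correction theorem: if `g = C * Cᴴ` is invertible
and `Cᴴ * C` commutes with `M`, then `O := C * M * Cᴴ * g⁻¹` satisfies
`O * C = C * M`, `Oᴴ = C * Mᴴ * Cᴴ * g⁻¹`, and `Oᴴ * C = C * Mᴴ`. -/
theorem reconstruction_matrix_identities {A B : Type*} [Fintype A] [Fintype B]
    [DecidableEq A] [DecidableEq B]
    (C : Matrix A B ℂ) (M : Matrix B B ℂ)
    (hg : IsUnit (C * Cᴴ))
    (hcomm : Cᴴ * C * M = M * (Cᴴ * C)) :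
    (C * M * Cᴴ * (C * Cᴴ)⁻¹) * C = C * M ∧
      (C * M * Cᴴ * (C * Cᴴ)⁻¹)ᴴ = C * Mᴴ * Cᴴ * (C * Cᴴ)⁻¹ ∧
      (C * M * Cᴴ * (C * Cᴴ)⁻¹)ᴴ * C = C * Mᴴ := by
  have hd := (Matrix.isUnit_iff_isUnit_det _).1 hg
  have h1 := Matrix.mul_nonsing_inv _ hd
  have h2 := Matrix.nonsing_inv_mul _ hd
  have hc' : Cᴴ * C * Mᴴ = Mᴴ * (Cᴴ * C) := by
    have := congrArg Matrix.conjTranspose hcomm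
    simp only [Matrix.conjTranspose_mul, Matrix.conjTranspose_conjTranspose] at this
    exact this.symm
  have a := recon_aux C M _ h1 h2 hcomm
  have b := recon_aux C Mᴴ _ h1 h2 hc'
  have e : (C * M * Cᴴ * (C * Cᴴ)⁻¹)ᴴ = C * Mᴴ * Cᴴ * (C * Cᴴ)⁻¹ := by
    rw [← b.2]
    simp only [Matrix.conjTranspose_mul, Matrix.conjTranspose_conjTranspose,
      Matrix.conjTranspose_nonsing_inv, Matrix.mul_assoc]
  exact ⟨a.1, e, by rw [e]; exact b.1⟩
end

section
/- Let |ĩ⟩ : Fin K → (E × Ē → ℂ) be an orthonormal family and φ the associated reference state with reduced density matrices ρ_RE[φ], ρ_R[φ], ρ_E[φ]. If ρ_RE[φ] = ρ_R[φ] ⊗ ρ_E[φ] (Kronecker product), then there exist an orthonormal basis e : E → (E → ℂ) of H_E, nonnegative reals c : E → ℝ with Σ_e c_e² = 1, and vectors ψ : Fin K → E → (Ē → ℂ) such that (i) |ĩ⟩ = Σ_e c_e · (e_e ⊗ ψ_{i,e}) for every i, and (ii) the vectors ψ_{i,e} with c_e ≠ 0 form an orthonormal family: ⟨ψ_{i,e},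 ψ_{j,e'}⟩ = δ_{ij} δ_{e e'} whenever c_e ≠ 0 and c_{e'} ≠ 0. -/
open scoped ComplexConjugate Matrix Kronecker

/-- The reference state `φ((i,m),a) = K^{-1/2}·ĩ(m,a)` obtained by entangling
the code subspace with a reference system `R = Fin K`. -/
noncomputable def refState {E Ebar : Type*} {K : ℕ} (ti : Fin K → (E × Ebar → ℂ)) :
    (Fin K × E) × Ebar → ℂ :=
  fun x => ((Real.sqrt K : ℝ) : ℂ)⁻¹ * ti x.1.1 (x.1.2, x.2)

/-- The reduced density matrix `ρ_RE[φ]` of the reference state on `R × E`. -/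
noncomputable def rhoRE {E Ebar : Type*} [Fintype Ebar] {K : ℕ}
    (ti : Fin K → (E × Ebar → ℂ)) : Matrix (Fin K × E) (Fin K × E) ℂ :=
  Matrix.of fun p q => ∑ a, refState ti (p, a) * conj (refState ti (q, a))

/-- The reduced density matrix `ρ_R[φ]` of the reference state on `R`. -/
noncomputable def rhoR {E Ebar : Type*} [Fintype E] [Fintype Ebar] {K : ℕ}
    (ti : Fin K → (E × Ebar → ℂ)) : Matrix (Fin K) (Fin K) ℂ :=
  Matrix.of fun i j => ∑ m, ∑ a, refState ti ((i, m), a) * conj (refState ti ((j, m), a))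

/-- The reduced density matrix `ρ_E[φ]` of the reference state on `E`. -/
noncomputable def rhoE {E Ebar : Type*} [Fintype Ebar] {K : ℕ}
    (ti : Fin K → (E × Ebar → ℂ)) : Matrix E E ℂ :=
  Matrix.of fun m n => ∑ i, ∑ a, refState ti ((i, m), a) * conj (refState ti ((i, n), a))

/-- If the reference state decouples, `ρ_RE[φ] = ρ_R[φ] ⊗ ρ_E[φ]`, then the code
states admit a Schmidt-type decomposition `|ĩ⟩ = Σ_e c_e (e_e ⊗ ψ_{i,e})` with
`e` an orthonormal basis of `H_E`, nonnegative weights `c` with `Σ c² = 1`, and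
the `ψ_{i,e}` (for `c_e ≠ 0`) an orthonormal family in `H_Ebar`. -/
theorem decoupling_implies_decomposition
    {E Ebar : Type*} [Fintype E] [Fintype Ebar] [Nonempty E] [Nonempty Ebar]
    [DecidableEq E] {K : ℕ}
    (ti : Fin K → (E × Ebar → ℂ))
    (horth : ∀ i j, ip (ti i) (ti j) = if i = j then 1 else 0)
    (hfact : rhoRE ti = rhoR ti ⊗ₖ rhoE ti) :
    ∃ (e : E → (E → ℂ)) (c : E → ℝ) (ψ : Fin K → E → (Ebar → ℂ)),
      (∀ m n, ip (e m) (e n) = if m = n then 1 else 0) ∧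
      (∀ m, 0 ≤ c m) ∧
      (∑ m, (c m) ^ 2 = 1) ∧
      (∀ i, ti i = fun p => ∑ m, ((c m : ℝ) : ℂ) * e m p.1 * ψ i m p.2) ∧
      (∀ i j m n, c m ≠ 0 → c n ≠ 0 →
        ip (ψ i m) (ψ j n) = if i = j ∧ m = n then 1 else 0) := by
  rcases Nat.eq_zero_or_pos K with hK | hK
  · subst hK
    obtain ⟨m0⟩ := ‹Nonempty E›
    refine ⟨fun m x => if m = x then 1 else 0, fun m => if m = m0 then 1 else 0,
      fun i => i.elim0, ?_, ?_, ?_, fun i => i.elim0, fun i => i.elim0⟩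
    · intro m n
      simp [ip, eq_comm]
    · intro m
      dsimp only
      split_ifs <;> norm_num
    · simp
  have hK0 : (K : ℂ) ≠ 0 := by exact_mod_cast hK.ne'
  have hsq : (((Real.sqrt K : ℝ) : ℂ)⁻¹) * (((Real.sqrt K : ℝ) : ℂ)⁻¹) = (K : ℂ)⁻¹ := by
    rw [← mul_inv, ← Complex.ofReal_mul, Real.mul_self_sqrt (Nat.cast_nonneg K)]
    simp
  have href : ∀ x y, refState ti x * conj (refState ti y)
      = (K : ℂ)⁻¹ * (ti x.1.1 (x.1.2, x.2) * conj (ti y.1.1 (y.1.2, y.2))) := by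
    intro x y
    rw [← hsq]
    simp only [refState, map_mul, map_inv₀, Complex.conj_ofReal]
    ring
  have horth' : ∀ i j, ∑ m, ∑ a, ti i (m, a) * conj (ti j (m, a)) = if i = j then 1 else 0 := by
    intro i j
    rw [← Fintype.sum_prod_type' (f := fun m a => ti i (m, a) * conj (ti j (m, a)))]
    have := horth j i
    simp only [ip] at this
    simp only [eq_comm (a := i)]
    rw [← this]
    exact Finset.sum_congr rfl fun x _ => mul_comm _ _
  have hR : ∀ i j, rhoR ti i j = if i = j then (K : ℂ)⁻¹ else 0 := by
    intro i j
    simp only [rhoR, Matrix.of_apply, href]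
    simp only [← Finset.mul_sum, horth']
    split_ifs <;> simp
  have hfac : ∀ i j m n, ∑ a, ti i (m, a) * conj (ti j (n, a))
      = if i = j then rhoE ti m n else 0 := by
    intro i j m n
    have h := congrFun (congrFun hfact (i, m)) (j, n)
    rw [Matrix.kronecker_apply, hR] at h
    simp only [rhoRE, Matrix.of_apply, href, ← Finset.mul_sum] at h
    have h2 := congrArg (fun z => (K : ℂ) * z) h
    simp only [mul_inv_cancel_left₀ hK0] at h2
    rw [h2]
    split_ifs
    · rw [mul_inv_cancel_left₀ hK0]
    · simp
  let i0 : Fin K := ⟨0, hK⟩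
  have hH : (rhoE ti).IsHermitian := by
    ext m n
    simp only [Matrix.conjTranspose_apply, rhoE, Matrix.of_apply, star_sum, star_mul']
    refine Finset.sum_congr rfl fun i _ => Finset.sum_congr rfl fun a _ => ?_
    simp [mul_comm]
  have htr : (rhoE ti).trace = 1 := by
    have h := horth' i0 i0
    simp only [hfac, if_true] at h
    exact h
  let U : Matrix E E ℂ := (hH.eigenvectorUnitary : Matrix E E ℂ)
  have hUU : Uᴴ * U = 1 := Unitary.coe_star_mul_self hH.eigenvectorUnitary
  have hUU' : U * Uᴴ = 1 := Unitary.coe_mul_star_self hH.eigenvectorUnitary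
  have hdiag : Uᴴ * rhoE ti * U = Matrix.diagonal (fun m => ((hH.eigenvalues m : ℝ) : ℂ)) := by
    have h := hH.spectral_theorem
    rw [Unitary.conjStarAlgAut_apply] at h
    change rhoE ti = U * Matrix.diagonal (fun m => ((hH.eigenvalues m : ℝ) : ℂ)) * Uᴴ at h
    generalize Matrix.diagonal (fun m => ((hH.eigenvalues m : ℝ) : ℂ)) = D at *
    rw [h]
    calc Uᴴ * (U * D * Uᴴ) * U = (Uᴴ * U) * D * (Uᴴ * U) := by simp only [Matrix.mul_assoc]
      _ = D := by simp [hUU]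
  let T : Fin K → Matrix E Ebar ℂ := fun i => Matrix.of fun m a => ti i (m, a)
  let X : Fin K → Matrix E Ebar ℂ := fun i => Uᴴ * T i
  have hTT : ∀ i j, T i * (T j)ᴴ = if i = j then rhoE ti else 0 := by
    intro i j
    ext m n
    have h := hfac i j m n
    simp only [Matrix.mul_apply, Matrix.conjTranspose_apply, T, Matrix.of_apply]
    refine Eq.trans h ?_
    split_ifs <;> rfl
  have hXX : ∀ i j, X i * (X j)ᴴ = if i = j
      then Matrix.diagonal (fun m => ((hH.eigenvalues m : ℝ) : ℂ)) else 0 := by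
    intro i j
    have : X i * (X j)ᴴ = Uᴴ * (T i * (T j)ᴴ) * U := by
      simp only [X, Matrix.conjTranspose_mul, Matrix.conjTranspose_conjTranspose,
        Matrix.mul_assoc]
    rw [this, hTT]
    split_ifs
    · exact hdiag
    · simp
  have hUX : ∀ i, U * X i = T i := by
    intro i
    simp only [X, ← Matrix.mul_assoc, hUU', Matrix.one_mul]
  have hX : ∀ i j m n, ∑ a, X i m a * conj (X j n a)
      = if i = j ∧ m = n then ((hH.eigenvalues m : ℝ) : ℂ) else 0 := by
    intro i j m n
    have h := congrFun (congrFun (hXX i j) m) n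
    simp only [Matrix.mul_apply, Matrix.conjTranspose_apply] at h
    refine Eq.trans h ?_
    by_cases hij : i = j <;> by_cases hmn : m = n <;> simp [hij, hmn]
  have hnorm : ∀ i m, ∑ a, Complex.normSq (X i m a) = hH.eigenvalues m := by
    intro i m
    have h := hX i i m m
    simp only [Complex.mul_conj, and_self, if_true] at h
    exact_mod_cast h
  have hnn : ∀ m, 0 ≤ hH.eigenvalues m := fun m => by
    rw [← hnorm i0 m]
    exact Finset.sum_nonneg fun a _ => Complex.normSq_nonneg _
  have hzero : ∀ i m a, hH.eigenvalues m = 0 → X i m a = 0 := by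
    intro i m a h0
    have h := hnorm i m
    rw [h0, Finset.sum_eq_zero_iff_of_nonneg fun a _ => Complex.normSq_nonneg _] at h
    exact Complex.normSq_eq_zero.1 (h a (Finset.mem_univ a))
  refine ⟨fun m x => U x m, fun m => Real.sqrt (hH.eigenvalues m),
    fun i m a => ((Real.sqrt (hH.eigenvalues m) : ℝ) : ℂ)⁻¹ * X i m a,
    ?_, fun m => Real.sqrt_nonneg _, ?_, ?_, ?_⟩
  · intro m n
    have h := congrFun (congrFun hUU m) n
    rw [Matrix.mul_apply, Matrix.one_apply] at h
    exact h
  · simp only [Real.sq_sqrt (hnn _)]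
    have h := hH.trace_eq_sum_eigenvalues
    rw [htr] at h
    have h2 : ((∑ m, hH.eigenvalues m : ℝ) : ℂ) = 1 := by
      push_cast
      exact h.symm
    exact_mod_cast h2
  · intro i
    funext p
    have h := congrFun (congrFun (hUX i) p.1) p.2
    rw [Matrix.mul_apply] at h
    refine Eq.trans (Eq.symm h) (Finset.sum_congr rfl fun m _ => ?_)
    by_cases h0 : hH.eigenvalues m = 0
    · simp [h0, hzero i m p.2 h0]
    · have hs : ((Real.sqrt (hH.eigenvalues m) : ℝ) : ℂ) ≠ 0 := by
        rw [Complex.ofReal_ne_zero, Real.sqrt_ne_zero (hnn m)]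
        exact h0
      dsimp only
      field_simp
  · intro i j m n hm hn
    have hs : ((Real.sqrt (hH.eigenvalues m) : ℝ) : ℂ) ≠ 0 := Complex.ofReal_ne_zero.2 hm
    have h := hX j i n m
    have h1 : ip (fun a => ((Real.sqrt (hH.eigenvalues m) : ℝ) : ℂ)⁻¹ * X i m a)
        (fun a => ((Real.sqrt (hH.eigenvalues n) : ℝ) : ℂ)⁻¹ * X j n a)
        = ((Real.sqrt (hH.eigenvalues m) : ℝ) : ℂ)⁻¹ *
          ((Real.sqrt (hH.eigenvalues n) : ℝ) : ℂ)⁻¹ * ∑ a, X j n a * conj (X i m a) := by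
      rw [ip, Finset.mul_sum]
      refine Finset.sum_congr rfl fun a _ => ?_
      simp only [map_mul, map_inv₀, Complex.conj_ofReal]
      ring
    refine Eq.trans h1 ?_
    rw [h]
    by_cases hij : i = j ∧ m = n
    · obtain ⟨rfl, rfl⟩ := hij
      simp only [and_self, if_true]
      rw [← mul_inv, ← Complex.ofReal_mul, Real.mul_self_sqrt (hnn m)]
      refine inv_mul_cancel₀ (Complex.ofReal_ne_zero.2 fun h0 => hm ?_)
      simp [h0]
    · rw [if_neg hij, if_neg fun h => hij ⟨h.1.symm, h.2.symm⟩, mul_zero]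
end

section
/- Let e : E → (E → ℂ) be an orthonormal basis of H_E, c : E → ℝ nonnegative reals, and ψ : Fin K → E → (Ē → ℂ) vectors satisfying ⟨ψ_{i,e}, ψ_{j,e'}⟩ = δ_{ij} δ_{e e'} whenever c_e ≠ 0 and c_{e'} ≠ 0. Define |ĩ⟩ := Σ_e c_e · (e_e ⊗ ψ_{i,e}). Then for every linear operator X_E on (E → ℂ) and all i, j in Fin K, ⟨ĩ| (X_E ⊗ I_Ē) |j̃⟩ = δ_{ij} · Σ_e c_e² ⟨e_e| X_E |e_e⟩. In particular, the erased subsystem E carries no information about the code subspace index. -/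
open scoped ComplexConjugate Matrix Kronecker

/-- If the code states have the decoupled form `|ĩ⟩ = Σ_e c_e (e_e ⊗ ψ_{i,e})`
with `e` orthonormal and the `ψ_{i,e}` (for `c_e ≠ 0`) orthonormal, then the
projection of any operator `X_E` on `E` onto the code subspace is proportional
to the identity: `⟨ĩ|(X_E ⊗ I)|j̃⟩ = δ_{ij} Σ_e c_e² ⟨e_e|X_E|e_e⟩`, so the
erased subsystem `E` carries no information about the code subspace index. -/
theorem decomposition_implies_no_information
    {E Ebar : Type*} [Fintype E] [Fintype Ebar] [Nonempty E] [Nonempty Ebar]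
    [DecidableEq E] {K : ℕ}
    (e : E → (E → ℂ)) (c : E → ℝ) (ψ : Fin K → E → (Ebar → ℂ))
    (he : ∀ m n, ip (e m) (e n) = if m = n then 1 else 0)
    (hc : ∀ m, 0 ≤ c m)
    (hψ : ∀ i j m n, c m ≠ 0 → c n ≠ 0 →
      ip (ψ i m) (ψ j n) = if i = j ∧ m = n then 1 else 0)
    (ti : Fin K → (E × Ebar → ℂ))
    (hti : ∀ i, ti i = fun p => ∑ m, ((c m : ℝ) : ℂ) * e m p.1 * ψ i m p.2) :
    ∀ (X : Matrix E E ℂ) (i j : Fin K),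
      ip (ti i) (actE X (ti j)) =
        (if i = j then 1 else 0) *
          ∑ m, (((c m) ^ 2 : ℝ) : ℂ) * ip (e m) (X.mulVec (e m)) := by
  intro X i j
  have h1 : actE X (ti j) = fun p => ∑ n, ((c n : ℝ) : ℂ) * X.mulVec (e n) p.1 * ψ j n p.2 := by
    funext p
    simp only [actE, hti, Matrix.mulVec, dotProduct, Finset.mul_sum, Finset.sum_mul]
    rw [Finset.sum_comm]
    refine Finset.sum_congr rfl fun n _ => Finset.sum_congr rfl fun m _ => ?_
    ring
  have h2 : ip (ti i) (actE X (ti j)) = ∑ m, ∑ n, ((c m : ℝ) : ℂ) * ((c n : ℝ) : ℂ) *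
      (ip (e m) (X.mulVec (e n)) * ip (ψ i m) (ψ j n)) := by
    rw [h1, hti]
    simp only [ip, map_sum, map_mul, Complex.conj_ofReal]
    simp only [Finset.sum_mul_sum]
    rw [Finset.sum_comm]
    refine Finset.sum_congr rfl fun m _ => ?_
    rw [Finset.sum_comm]
    refine Finset.sum_congr rfl fun n _ => ?_
    rw [Fintype.sum_prod_type, Finset.mul_sum]
    refine Finset.sum_congr rfl fun x _ => ?_
    rw [Finset.mul_sum]
    refine Finset.sum_congr rfl fun a _ => ?_
    ring
  rw [h2, Finset.mul_sum]
  refine Finset.sum_congr rfl fun m _ => ?_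
  rw [Finset.sum_eq_single m]
  · by_cases hm : c m = 0
    · simp [hm]
    · rw [hψ i j m m hm hm]
      by_cases hij : i = j
      · simp [hij, sq]
      · simp [hij]
  · intro n _ hn
    by_cases hm : c m = 0
    · simp [hm]
    by_cases hn0 : c n = 0
    · simp [hn0]
    rw [hψ i j m n hm hn0, if_neg (fun h => hn h.2.symm)]
    simp
  · simp
end

section
/- Let |ĩ⟩ : Fin K → (E × Ē → ℂ) be an orthonormal family and φ the associated reference state with reduced density matrices ρ_RE[φ], ρ_R[φ], ρ_E[φ]. Then the following are equivalent: (1) for every linear operator X_E on (E → ℂ) there exists a constant c(X_E) ∈ ℂ such that ⟨ĩ| (X_E ⊗ I_Ē) |j̃⟩ = δ_{ij} · c(X_E) for all i, j; (2) ρ_RE[φ] = ρ_R[φ] ⊗ ρ_E[φ] (Kronecker product). -/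
open scoped ComplexConjugate Matrix Kronecker

noncomputable def GG {E Ebar : Type*} [Fintype Ebar] {K : ℕ}
    (ti : Fin K → (E × Ebar → ℂ)) (i j : Fin K) (m n : E) : ℂ :=
  ∑ a, ti i (m, a) * conj (ti j (n, a))

lemma ref_mul {E Ebar : Type*} {K : ℕ} (ti : Fin K → (E × Ebar → ℂ)) (i j : Fin K) (m n : E)
    (a : Ebar) : refState ti ((i, m), a) * conj (refState ti ((j, n), a)) =
      (K : ℂ)⁻¹ * (ti i (m, a) * conj (ti j (n, a))) := by
  have h : ((Real.sqrt K : ℝ) : ℂ) * ((Real.sqrt K : ℝ) : ℂ) = (K : ℂ) := by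
    rw [← Complex.ofReal_mul, Real.mul_self_sqrt (Nat.cast_nonneg K)]
    simp
  simp only [refState, map_mul, map_inv₀, Complex.conj_ofReal]
  rw [← h, mul_inv]
  ring

lemma rhoRE_GG {E Ebar : Type*} [Fintype Ebar] {K : ℕ}
    (ti : Fin K → (E × Ebar → ℂ)) (i j : Fin K) (m n : E) :
    rhoRE ti (i, m) (j, n) = (K : ℂ)⁻¹ * GG ti i j m n := by
  simp only [rhoRE, Matrix.of_apply, ref_mul, GG, Finset.mul_sum]

lemma rhoE_GG {E Ebar : Type*} [Fintype Ebar] {K : ℕ}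
    (ti : Fin K → (E × Ebar → ℂ)) (m n : E) :
    rhoE ti m n = (K : ℂ)⁻¹ * ∑ i, GG ti i i m n := by
  simp only [rhoE, Matrix.of_apply, ref_mul, GG, Finset.mul_sum]

lemma rhoR_eq {E Ebar : Type*} [Fintype E] [Fintype Ebar] {K : ℕ}
    (ti : Fin K → (E × Ebar → ℂ))
    (horth : ∀ i j, ip (ti i) (ti j) = if i = j then 1 else 0) (i j : Fin K) :
    rhoR ti i j = (K : ℂ)⁻¹ * (if i = j then 1 else 0) := by
  have h := horth j i
  simp only [ip, Fintype.sum_prod_type] at h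
  simp only [rhoR, Matrix.of_apply, ref_mul, ← Finset.mul_sum]
  congr 1
  simp only [eq_comm (a := i), ← h, mul_comm]

lemma ip_GG {E Ebar : Type*} [Fintype E] [Fintype Ebar] {K : ℕ}
    (ti : Fin K → (E × Ebar → ℂ)) (X : Matrix E E ℂ) (i j : Fin K) :
    ip (ti i) (actE X (ti j)) = ∑ m, ∑ n, X m n * GG ti j i n m := by
  simp only [ip, actE, GG, Fintype.sum_prod_type, Finset.mul_sum]
  refine Finset.sum_congr rfl fun m _ => ?_
  rw [Finset.sum_comm]
  refine Finset.sum_congr rfl fun n _ => Finset.sum_congr rfl fun a _ => ?_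
  ring

/-- **The erasure correction condition.** For an orthonormal code family `ti`,
the projection of every operator `X_E` on `E` onto the code subspace is
proportional to the identity if and only if the reference state decouples:
`ρ_RE[φ] = ρ_R[φ] ⊗ ρ_E[φ]`. -/
theorem no_information_iff_decoupling
    {E Ebar : Type*} [Fintype E] [Fintype Ebar] [Nonempty E] [Nonempty Ebar] {K : ℕ}
    (ti : Fin K → (E × Ebar → ℂ))
    (horth : ∀ i j, ip (ti i) (ti j) = if i = j then 1 else 0) :
    (∀ X : Matrix E E ℂ, ∃ c : ℂ, ∀ i j,
        ip (ti i) (actE X (ti j)) = (if i = j then 1 else 0) * c) ↔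
      rhoRE ti = rhoR ti ⊗ₖ rhoE ti := by
  classical
  rcases Nat.eq_zero_or_pos K with rfl | hK
  · constructor
    · intro _
      ext ⟨i, m⟩ _
      exact i.elim0
    · intro _ X
      exact ⟨0, fun i => i.elim0⟩
  have hK0 : (K : ℂ) ≠ 0 := by exact_mod_cast hK.ne'
  constructor
  · intro h
    ext ⟨i, m⟩ ⟨j, n⟩
    obtain ⟨c, hc⟩ := h (Matrix.of fun a b => if a = n then (if b = m then 1 else 0) else 0)
    have hG : ∀ i j, GG ti i j m n = (if i = j then 1 else 0) * c := by
      intro i j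
      have := hc j i
      rw [ip_GG] at this
      simpa [eq_comm] using this
    rw [Matrix.kroneckerMap_apply, rhoRE_GG, rhoR_eq ti horth, rhoE_GG]
    simp only [hG]
    simp [hK0]
  · intro h X
    refine ⟨∑ m, ∑ n, X m n * rhoE ti n m, fun i j => ?_⟩
    rw [ip_GG]
    simp only [Finset.mul_sum]
    refine Finset.sum_congr rfl fun m _ => Finset.sum_congr rfl fun n _ => ?_
    have h1 := congrFun (congrFun h (j, n)) (i, m)
    rw [Matrix.kroneckerMap_apply, rhoRE_GG, rhoR_eq ti horth, mul_assoc] at h1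
    rw [mul_left_cancel₀ (inv_ne_zero hK0) h1]
    simp only [eq_comm (a := j)]
    ring
end

section
/- Let |ĩ⟩ : Fin K → (E × Ē → ℂ) be an orthonormal family, let X_E be an operator on (E → ℂ) and c ∈ ℂ with ⟨ĩ| (X_E ⊗ I_Ē) |j̃⟩ = δ_{ij} · c for all i, j, and let O be an operator acting within the code subspace with logical matrix L. Then for every unit vector ψ̃ in the code subspace, the connected correlator vanishes: ⟨ψ̃| O (X_E ⊗ I_Ē) |ψ̃⟩ = ⟨ψ̃| O |ψ̃⟩ · ⟨ψ̃| (X_E ⊗ I_Ē) |ψ̃⟩. -/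
open scoped ComplexConjugate Matrix Kronecker

theorem ip_add_left' {ι : Type*} [Fintype ι] (u v w : ι → ℂ) :
    ip (u + v) w = ip u w + ip v w := by
  simp [ip, add_mul, Finset.sum_add_distrib]

theorem ip_add_right' {ι : Type*} [Fintype ι] (u v w : ι → ℂ) :
    ip u (v + w) = ip u v + ip u w := by
  simp [ip, mul_add, Finset.sum_add_distrib]

theorem ip_smul_left' {ι : Type*} [Fintype ι] (a : ℂ) (v w : ι → ℂ) :
    ip (a • v) w = conj a * ip v w := by
  simp [ip, Finset.mul_sum, mul_assoc]

theorem ip_smul_right' {ι : Type*} [Fintype ι] (a : ℂ) (v w : ι → ℂ) :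
    ip v (a • w) = a * ip v w := by
  simp [ip, Finset.mul_sum, mul_left_comm]

theorem actE_add' {E Ebar : Type*} [Fintype E] (X : Matrix E E ℂ) (v w : E × Ebar → ℂ) :
    actE X (v + w) = actE X v + actE X w := by
  funext p
  simp [actE, mul_add, Finset.sum_add_distrib]

theorem actE_smul' {E Ebar : Type*} [Fintype E] (X : Matrix E E ℂ) (a : ℂ)
    (v : E × Ebar → ℂ) : actE X (a • v) = a • actE X v := by
  funext p
  simp [actE, Finset.mul_sum, mul_left_comm]

theorem ip_mulVec' {ι : Type*} [Fintype ι] (O : Matrix ι ι ℂ) (v w : ι → ℂ) :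
    ip v (O.mulVec w) = ip (Oᴴ.mulVec v) w := by
  simp only [ip, Matrix.mulVec, dotProduct, Finset.mul_sum, map_sum, Finset.sum_mul, map_mul,
    Matrix.conjTranspose_apply, Complex.star_def, Complex.conj_conj]
  rw [Finset.sum_comm]
  refine Finset.sum_congr rfl fun x _ => Finset.sum_congr rfl fun y _ => ?_
  ring

theorem ip_actE_span {E Ebar : Type*} [Fintype E] [Fintype Ebar] {K : ℕ}
    (ti : Fin K → (E × Ebar → ℂ))
    (horth : ∀ i j, ip (ti i) (ti j) = if i = j then 1 else 0)
    (X : Matrix E E ℂ) (c : ℂ)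
    (hX : ∀ i j, ip (ti i) (actE X (ti j)) = (if i = j then 1 else 0) * c)
    (u v : E × Ebar → ℂ) (hu : u ∈ Submodule.span ℂ (Set.range ti))
    (hv : v ∈ Submodule.span ℂ (Set.range ti)) :
    ip u (actE X v) = ip u v * c := by
  induction hu using Submodule.span_induction with
  | mem u hu =>
    obtain ⟨i, rfl⟩ := hu
    induction hv using Submodule.span_induction with
    | mem v hv =>
      obtain ⟨j, rfl⟩ := hv
      rw [hX, horth]
    | zero => simp [ip, actE]
    | add x y _ _ hx hy => rw [actE_add', ip_add_right', ip_add_right', hx, hy, add_mul]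
    | smul a x _ hx => rw [actE_smul', ip_smul_right', ip_smul_right', hx, mul_assoc]
  | zero => simp [ip]
  | add x y _ _ hx hy => rw [ip_add_left', ip_add_left', hx, hy, add_mul]
  | smul a x _ hx => rw [ip_smul_left', ip_smul_left', hx, mul_assoc]

/-- If the projection of `X_E` onto the code subspace is proportional to the
identity, then for any operator `O` acting within the code subspace and any
unit vector `ψ` of the code subspace, the connected correlator of `O` and
`X_E ⊗ I` vanishes: `⟨ψ|O(X_E ⊗ I)|ψ⟩ = ⟨ψ|O|ψ⟩ ⟨ψ|(X_E ⊗ I)|ψ⟩`. -/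
theorem connected_correlator_vanishes
    {E Ebar : Type*} [Fintype E] [Fintype Ebar] [Nonempty E] [Nonempty Ebar] {K : ℕ}
    (ti : Fin K → (E × Ebar → ℂ))
    (horth : ∀ i j, ip (ti i) (ti j) = if i = j then 1 else 0)
    (X : Matrix E E ℂ) (c : ℂ)
    (hX : ∀ i j, ip (ti i) (actE X (ti j)) = (if i = j then 1 else 0) * c)
    (O : Matrix (E × Ebar) (E × Ebar) ℂ) (L : Matrix (Fin K) (Fin K) ℂ)
    (hO : ∀ i, O.mulVec (ti i) = ∑ j, L j i • ti j)
    (hOd : ∀ i, (Oᴴ).mulVec (ti i) = ∑ j, conj (L i j) • ti j)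
    (ψ : E × Ebar → ℂ) (hmem : ψ ∈ Submodule.span ℂ (Set.range ti))
    (hunit : ip ψ ψ = 1) :
    ip ψ (O.mulVec (actE X ψ)) = ip ψ (O.mulVec ψ) * ip ψ (actE X ψ) := by
  have hspan : (Oᴴ).mulVec ψ ∈ Submodule.span ℂ (Set.range ti) := by
    clear hunit
    induction hmem using Submodule.span_induction with
    | mem u hu =>
      obtain ⟨i, rfl⟩ := hu
      rw [hOd]
      exact Submodule.sum_mem _ fun j _ =>
        Submodule.smul_mem _ _ (Submodule.subset_span ⟨j, rfl⟩)
    | zero => simp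
    | add x y _ _ hx hy => rw [Matrix.mulVec_add]; exact Submodule.add_mem _ hx hy
    | smul a x _ hx => rw [Matrix.mulVec_smul]; exact Submodule.smul_mem _ _ hx
  rw [ip_mulVec', ip_mulVec', ip_actE_span ti horth X c hX _ _ hspan hmem,
    ip_actE_span ti horth X c hX _ _ hmem hmem, hunit, one_mul]
end

section
/- Let |ĩ⟩ : Fin K → (E × Ē → ℂ) be an orthonormal family spanning a code subspace, and let O and O' be operators acting within the code subspace (with logical matrices L and L'). Suppose there exists an operator O_Ē on (Ē → ℂ) with (I_E ⊗ O_Ē)|ψ̃⟩ = O|ψ̃⟩ and (I_E ⊗ O_Ē)ᴴ|ψ̃⟩ = Oᴴ|ψ̃⟩ for all ψ̃ in the code subspace, and there exists an operator O'_E on (E → ℂ) with (O'_E ⊗ I_Ē)|ψ̃⟩ = O'|ψ̃⟩ and (O'_E ⊗ I_Ē)ᴴ|ψ̃⟩ = O'ᴴ|ψ̃⟩ for all ψ̃ in the code subspace. Then O and O' commute on the code subspace: the logical matrices satisfy L * L' = L' * L. (Hence a non-abelian algebra of logical operators cannot be represented both on Ē and on E.) -/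
open scoped ComplexConjugate Matrix Kronecker

/-- **Algebraic no-cloning.** If a logical operator `O` can be represented on
`Ebar` and a logical operator `O'` can be represented on `E` (both together
with their conjugate transposes, on the whole code subspace), then the two
logical matrices commute; hence a non-abelian algebra of logical operators
cannot be represented on both complementary factors. -/
theorem algebraic_no_cloning
    {E Ebar : Type*} [Fintype E] [Fintype Ebar] [Nonempty E] [Nonempty Ebar] {K : ℕ}
    (ti : Fin K → (E × Ebar → ℂ))
    (horth : ∀ i j, ip (ti i) (ti j) = if i = j then 1 else 0)
    (O O' : Matrix (E × Ebar) (E × Ebar) ℂ) (L L' : Matrix (Fin K) (Fin K) ℂ)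
    (hO : ∀ i, O.mulVec (ti i) = ∑ j, L j i • ti j)
    (hOd : ∀ i, (Oᴴ).mulVec (ti i) = ∑ j, conj (L i j) • ti j)
    (hO' : ∀ i, O'.mulVec (ti i) = ∑ j, L' j i • ti j)
    (hO'd : ∀ i, (O'ᴴ).mulVec (ti i) = ∑ j, conj (L' i j) • ti j)
    (hrecEbar : ∃ OEb : Matrix Ebar Ebar ℂ,
        ∀ ψ ∈ Submodule.span ℂ (Set.range ti),
          actEbar OEb ψ = O.mulVec ψ ∧ actEbar (OEbᴴ) ψ = (Oᴴ).mulVec ψ)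
    (hrecE : ∃ OE : Matrix E E ℂ,
        ∀ ψ ∈ Submodule.span ℂ (Set.range ti),
          actE OE ψ = O'.mulVec ψ ∧ actE (OEᴴ) ψ = (O'ᴴ).mulVec ψ) :
    L * L' = L' * L := by
  obtain ⟨Y, hY⟩ := hrecEbar
  obtain ⟨X, hX⟩ := hrecE
  have mem : ∀ i, ti i ∈ Submodule.span ℂ (Set.range ti) := fun i =>
    Submodule.subset_span ⟨i, rfl⟩
  have memS : ∀ c : Fin K → ℂ, ∑ j, c j • ti j ∈ Submodule.span ℂ (Set.range ti) := fun c =>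
    Submodule.sum_mem _ fun j _ => Submodule.smul_mem _ _ (mem j)
  have comm : ∀ v : E × Ebar → ℂ, actEbar Y (actE X v) = actE X (actEbar Y v) := by
    intro v
    funext p
    simp only [actE, actEbar, Finset.mul_sum]
    rw [Finset.sum_comm]
    refine Finset.sum_congr rfl fun a _ => Finset.sum_congr rfl fun b _ => ?_
    ring
  have lin : ∀ (M : Matrix (E × Ebar) (E × Ebar) ℂ) (N N' : Matrix (Fin K) (Fin K) ℂ),
      (∀ i, M.mulVec (ti i) = ∑ j, N j i • ti j) → ∀ i,
      M.mulVec (∑ j, N' j i • ti j) = ∑ k, (N * N') k i • ti k := by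
    intro M N N' h i
    rw [Matrix.mulVec_sum]
    simp only [Matrix.mulVec_smul, h, Finset.smul_sum, Matrix.mul_apply, Finset.sum_smul,
      smul_smul]
    rw [Finset.sum_comm]
    simp only [mul_comm]
  have coef : ∀ (c : Fin K → ℂ) (k : Fin K), ip (ti k) (∑ j, c j • ti j) = c k := by
    intro c k
    have : ip (ti k) (∑ j, c j • ti j) = ∑ j, c j * ip (ti k) (ti j) := by
      simp only [ip, Finset.sum_apply, Pi.smul_apply, smul_eq_mul, Finset.mul_sum]
      rw [Finset.sum_comm]
      refine Finset.sum_congr rfl fun a _ => Finset.sum_congr rfl fun b _ => ?_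
      ring
    rw [this]
    simp [horth]
  ext k i
  have h := comm (ti i)
  rw [(hX _ (mem i)).1, (hY _ (mem i)).1, hO, hO', (hY _ (memS _)).1, (hX _ (memS _)).1,
    lin O L L' hO, lin O' L' L hO'] at h
  have h2 := congrArg (ip (ti k)) h
  rwa [coef (fun k => (L * L') k i), coef (fun k => (L' * L) k i)] at h2
end

section
/- Let |ĩ⟩ : Fin K → (E × Ē → ℂ) be an orthonormal family with associated reference state φ and reduced density matrices ρ_RE[φ], ρ_R[φ], ρ_E[φ]. If ρ_RE[φ] = ρ_R[φ] ⊗ ρ_E[φ] and ρ_E[φ] has full rank (rank equal to the cardinality of E), then the dimension of the complementary factor satisfies Fintype.card Ē ≥ K · Fintype.card E. (This is the counting bound n ≥ 2l + k for erasure-correcting codes.) -/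
open scoped ComplexConjugate Matrix Kronecker

/-- **The counting bound `n ≥ 2l + k`.** If the reference state decouples and
`ρ_E[φ]` has full rank, then the dimension of the complementary factor obeys
`dim H_Ebar ≥ K · dim H_E`. -/
theorem counting_bound
    {E Ebar : Type*} [Fintype E] [Fintype Ebar] [Nonempty E] [Nonempty Ebar] {K : ℕ}
    (ti : Fin K → (E × Ebar → ℂ))
    (horth : ∀ i j, ip (ti i) (ti j) = if i = j then 1 else 0)
    (hfact : rhoRE ti = rhoR ti ⊗ₖ rhoE ti)
    (hrank : (rhoE ti).rank = Fintype.card E) :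
    K * Fintype.card E ≤ Fintype.card Ebar := by
  classical
  rcases Nat.eq_zero_or_pos K with h0 | hK
  · subst h0; simp
  have hKc : (K : ℂ) ≠ 0 := by exact_mod_cast hK.ne'
  have hs : (((Real.sqrt K : ℝ) : ℂ)⁻¹ * ((Real.sqrt K : ℝ) : ℂ)⁻¹) = (K : ℂ)⁻¹ := by
    rw [← mul_inv, ← Complex.ofReal_mul, Real.mul_self_sqrt (Nat.cast_nonneg K)]
    simp
  have hR : rhoR ti = (K : ℂ)⁻¹ • (1 : Matrix (Fin K) (Fin K) ℂ) := by
    ext i j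
    have h := horth j i
    simp only [ip, Fintype.sum_prod_type] at h
    simp only [rhoR, Matrix.of_apply, refState, Matrix.smul_apply, Matrix.one_apply, smul_eq_mul]
    simp only [eq_comm (a := i) (b := j)]
    rw [← h, ← hs, Finset.mul_sum]
    refine Finset.sum_congr rfl fun m _ => ?_
    rw [Finset.mul_sum]
    refine Finset.sum_congr rfl fun a _ => ?_
    rw [map_mul, map_inv₀, Complex.conj_ofReal]
    ring
  have hUR : IsUnit (rhoR ti) := by
    rw [hR, Matrix.isUnit_iff_isUnit_det, Matrix.det_smul, Matrix.det_one, mul_one]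
    exact (isUnit_iff_ne_zero.mpr (inv_ne_zero hKc)).pow _
  have hUE : IsUnit (rhoE ti) := by
    rw [← Matrix.mulVec_surjective_iff_isUnit]
    have : LinearMap.range (rhoE ti).mulVecLin = ⊤ := by
      apply Submodule.eq_top_of_finrank_eq
      rw [Module.finrank_fintype_fun_eq_card]
      exact hrank
    exact LinearMap.range_eq_top.mp this
  have hU : IsUnit (rhoRE ti) := by
    rw [hfact]
    exact Matrix.IsUnit.kronecker hUR hUE
  have hr := Matrix.rank_of_isUnit _ hU
  let A : Matrix (Fin K × E) Ebar ℂ := Matrix.of fun p a => refState ti (p, a)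
  have hA : rhoRE ti = A * Aᴴ := by
    ext p q
    simp [rhoRE, A, Matrix.mul_apply]
  rw [hA] at hr
  have h1 := (Matrix.rank_mul_le_left A Aᴴ).trans (Matrix.rank_le_card_width A)
  rw [hr, Fintype.card_prod, Fintype.card_fin] at h1
  exact h1
end

section
/- Let |0̃⟩, |1̃⟩, |2̃⟩ be the three-qutrit code states. Then for each of the three qutrit positions p ∈ {1,2,3} and every matrix X : Matrix (Fin 3) (Fin 3) ℂ, acting with X on position p and the identity on the other two positions gives ⟨ĩ| X^{(p)} |j̃⟩ = δ_{ij} · (trace X)/3 for all i, j ∈ {0,1,2}. In particular no single qutrit carries any information about the encoded state. -/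
open scoped ComplexConjugate Matrix

/-- The standard basis vector `|abc⟩` of the three-qutrit Hilbert space. -/
noncomputable def ket3 (a b c : Fin 3) : Fin 3 × Fin 3 × Fin 3 → ℂ :=
  fun p => if p = (a, b, c) then 1 else 0

/-- The three-qutrit code states `|0̃⟩, |1̃⟩, |2̃⟩`. -/
noncomputable def qcode : Fin 3 → (Fin 3 × Fin 3 × Fin 3 → ℂ) :=
  ![((Real.sqrt 3 : ℝ) : ℂ)⁻¹ • (ket3 0 0 0 + ket3 1 1 1 + ket3 2 2 2),
    ((Real.sqrt 3 : ℝ) : ℂ)⁻¹ • (ket3 0 1 2 + ket3 1 2 0 + ket3 2 0 1),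
    ((Real.sqrt 3 : ℝ) : ℂ)⁻¹ • (ket3 0 2 1 + ket3 1 0 2 + ket3 2 1 0)]

/-- The action `X^{(1)}` of a single-qutrit operator on the first qutrit. -/
noncomputable def act1 (X : Matrix (Fin 3) (Fin 3) ℂ)
    (v : Fin 3 × Fin 3 × Fin 3 → ℂ) : Fin 3 × Fin 3 × Fin 3 → ℂ :=
  fun p => ∑ a', X p.1 a' * v (a', p.2.1, p.2.2)

/-- The action `X^{(2)}` of a single-qutrit operator on the second qutrit. -/
noncomputable def act2 (X : Matrix (Fin 3) (Fin 3) ℂ)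
    (v : Fin 3 × Fin 3 × Fin 3 → ℂ) : Fin 3 × Fin 3 × Fin 3 → ℂ :=
  fun p => ∑ b', X p.2.1 b' * v (p.1, b', p.2.2)

/-- The action `X^{(3)}` of a single-qutrit operator on the third qutrit. -/
noncomputable def act3 (X : Matrix (Fin 3) (Fin 3) ℂ)
    (v : Fin 3 × Fin 3 × Fin 3 → ℂ) : Fin 3 × Fin 3 × Fin 3 → ℂ :=
  fun p => ∑ c', X p.2.2 c' * v (p.1, p.2.1, c')

/-- In the three-qutrit code, for every single-qutrit operator `X` acting on
any one of the three positions, `⟨ĩ|X^{(p)}|j̃⟩ = δ_{ij}·(trace X)/3`: no single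
qutrit carries any information about the encoded state. -/
theorem three_qutrit_single_qutrit_no_information
    (X : Matrix (Fin 3) (Fin 3) ℂ) (i j : Fin 3) :
    ip (qcode i) (act1 X (qcode j)) = (if i = j then 1 else 0) * (X.trace / 3) ∧
    ip (qcode i) (act2 X (qcode j)) = (if i = j then 1 else 0) * (X.trace / 3) ∧
    ip (qcode i) (act3 X (qcode j)) = (if i = j then 1 else 0) * (X.trace / 3) := by
  have h : ((Real.sqrt 3 : ℝ) : ℂ)⁻¹ * ((Real.sqrt 3 : ℝ) : ℂ)⁻¹ = 1 / 3 := by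
    rw [← mul_inv, ← Complex.ofReal_mul, Real.mul_self_sqrt (by norm_num)]
    norm_num
  have hc : conj (((Real.sqrt 3 : ℝ) : ℂ)⁻¹) = ((Real.sqrt 3 : ℝ) : ℂ)⁻¹ := by
    rw [map_inv₀, Complex.conj_ofReal]
  unfold qcode
  generalize ((Real.sqrt 3 : ℝ) : ℂ)⁻¹ = r at h hc ⊢
  fin_cases i <;> fin_cases j <;> refine ⟨?_, ?_, ?_⟩ <;>
    simp [ip, act1, act2, act3, ket3, Fintype.sum_prod_type, Fin.sum_univ_three,
      Matrix.trace, hc] <;>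
    linear_combination (X 0 0 + X 1 1 + X 2 2) * h
end

section
/- Let |0̃⟩, |1̃⟩, |2̃⟩ be the three-qutrit code states and let χ := (|00⟩+|11⟩+|22⟩)/√3 ∈ (Fin 3 × Fin 3 → ℂ). Then for each pair of distinct qutrit positions there is a recovery unitary acting only on that pair: (1) there exists a unitary U on (Fin 3 × Fin 3 → ℂ) such that applying U to positions (1,2) and the identity to position 3 maps |ĩ⟩ to the vector v with v(a,b,c) = (standard basis at a = i) · χ(b,c); and similarly (2) for positions (2,3) there exists such a unitary placing |i⟩ in position 2 with χ on positions (3,1); and (3) for positions (1,3) there exists such a unitary placing |i⟩ in position 1 with χ on positions (3,2). -/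
open scoped ComplexConjugate Matrix

/-- The maximally entangled two-qutrit state `χ = (|00⟩+|11⟩+|22⟩)/√3`. -/
noncomputable def chi : Fin 3 × Fin 3 → ℂ :=
  fun p => if p.1 = p.2 then ((Real.sqrt 3 : ℝ) : ℂ)⁻¹ else 0

/-- A two-qutrit operator `U` acting on positions (1,2) of a three-qutrit vector. -/
noncomputable def apply12 (U : Matrix (Fin 3 × Fin 3) (Fin 3 × Fin 3) ℂ)
    (v : Fin 3 × Fin 3 × Fin 3 → ℂ) : Fin 3 × Fin 3 × Fin 3 → ℂ :=
  fun p => ∑ q : Fin 3 × Fin 3, U (p.1, p.2.1) q * v (q.1, q.2, p.2.2)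

/-- A two-qutrit operator `U` acting on positions (2,3) of a three-qutrit vector. -/
noncomputable def apply23 (U : Matrix (Fin 3 × Fin 3) (Fin 3 × Fin 3) ℂ)
    (v : Fin 3 × Fin 3 × Fin 3 → ℂ) : Fin 3 × Fin 3 × Fin 3 → ℂ :=
  fun p => ∑ q : Fin 3 × Fin 3, U (p.2.1, p.2.2) q * v (p.1, q.1, q.2)

/-- A two-qutrit operator `U` acting on positions (1,3) of a three-qutrit vector. -/
noncomputable def apply13 (U : Matrix (Fin 3 × Fin 3) (Fin 3 × Fin 3) ℂ)
    (v : Fin 3 × Fin 3 × Fin 3 → ℂ) : Fin 3 × Fin 3 × Fin 3 → ℂ :=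
  fun p => ∑ q : Fin 3 × Fin 3, U (p.1, p.2.2) q * v (q.1, p.2.1, q.2)

theorem qcode_apply (i a b c : Fin 3) :
    qcode i (a, b, c) = if b = a + i ∧ c = a + 2 * i then ((Real.sqrt 3 : ℝ) : ℂ)⁻¹ else 0 := by
  fin_cases i <;> fin_cases a <;> fin_cases b <;> fin_cases c <;> simp [qcode, ket3]

/-- The permutation matrix attached to a map of basis labels. -/
noncomputable def permU (f : Fin 3 × Fin 3 → Fin 3 × Fin 3) :
    Matrix (Fin 3 × Fin 3) (Fin 3 × Fin 3) ℂ := fun p q => if q = f p then 1 else 0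

theorem permU_mem (f : Fin 3 × Fin 3 → Fin 3 × Fin 3) (hf : Function.Injective f) :
    permU f ∈ Matrix.unitaryGroup (Fin 3 × Fin 3) ℂ := by
  rw [Matrix.mem_unitaryGroup_iff]
  ext p q
  simp [Matrix.mul_apply, Matrix.star_apply, permU, Matrix.one_apply, hf.eq_iff, apply_ite]
  split_ifs with h
  · exact h.symm
  · exact fun h2 => h h2.symm

/-- **Recovery unitaries for the three-qutrit code.** For each pair of qutrit
positions there is a unitary acting only on that pair which decodes the
encoded qutrit: on positions (1,2) it maps `|ĩ⟩` to `|i⟩₁ ⊗ χ_{(2,3)}`, on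
positions (2,3) it places `|i⟩` in position 2 with `χ` on positions (3,1), and
on positions (1,3) it places `|i⟩` in position 1 with `χ` on positions (3,2). -/
theorem three_qutrit_recovery_unitaries :
    (∃ U ∈ Matrix.unitaryGroup (Fin 3 × Fin 3) ℂ,
        ∀ i, apply12 U (qcode i) =
          fun p => (if p.1 = i then 1 else 0) * chi (p.2.1, p.2.2)) ∧
    (∃ U ∈ Matrix.unitaryGroup (Fin 3 × Fin 3) ℂ,
        ∀ i, apply23 U (qcode i) =
          fun p => (if p.2.1 = i then 1 else 0) * chi (p.2.2, p.1)) ∧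
    (∃ U ∈ Matrix.unitaryGroup (Fin 3 × Fin 3) ℂ,
        ∀ i, apply13 U (qcode i) =
          fun p => (if p.1 = i then 1 else 0) * chi (p.2.2, p.2.1)) := by
  refine ⟨?_, ?_, ?_⟩
  · refine ⟨permU (fun p => (p.2 + p.1, p.2 + 2 * p.1)), permU_mem _ (by decide), fun i => ?_⟩
    funext ⟨a, b, c⟩
    simp only [apply12, permU, ite_mul, one_mul, zero_mul, Finset.sum_ite_eq', Finset.sum_ite_eq,
      Finset.mem_univ, if_true]
    simp only [qcode_apply, chi, ← ite_and]
    refine if_congr ?_ rfl rfl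
    revert i a b c
    decide
  · refine ⟨permU (fun p => (p.2 + p.1, p.2 + 2 * p.1)), permU_mem _ (by decide), fun i => ?_⟩
    funext ⟨a, b, c⟩
    simp only [apply23, permU, ite_mul, one_mul, zero_mul, Finset.sum_ite_eq', Finset.sum_ite_eq,
      Finset.mem_univ, if_true]
    simp only [qcode_apply, chi, ← ite_and]
    refine if_congr ?_ rfl rfl
    revert i a b c
    decide
  · refine ⟨permU (fun p => (p.2 + 2 * p.1, p.2 + p.1)), permU_mem _ (by decide), fun i => ?_⟩
    funext ⟨a, b, c⟩
    simp only [apply13, permU, ite_mul, one_mul, zero_mul, Finset.sum_ite_eq', Finset.sum_ite_eq,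
      Finset.mem_univ, if_true]
    simp only [qcode_apply, chi, ← ite_and]
    refine if_congr ?_ rfl rfl
    revert i a b c
    decide
end

section
/- Let α > 1 be real, set f(x) := x² + 1 − α (the BTZ blackening factor), and let r₊ := √(α−1) be the positive root of f. Then for every r > r₊, the improper integral ∫_{r}^{∞} f(r')^{-3/2} · ( √(f(r)/f(r')) − 1/2 ) dr' is strictly positive. (Equivalently, setting u := r/√(α−1) > 1, this reduces to the elementary inequality √(u²−1) · log((u+1)/(u−1)) < 2 for all u > 1.) This is the statement that the causal wedge of a fixed boundary region recedes, in renormalized geodesic distance, as the BTZ black hole mass increases. -/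
open MeasureTheory

open Filter Topology in
lemma btz_aux1 (a r : ℝ) (ha : 0 < a) (hr : a < r) :
    IntegrableOn (fun x : ℝ => ((x^2 - a^2)^2)⁻¹) (Set.Ioi r) ∧
    ∫ x in Set.Ioi r, ((x^2 - a^2)^2)⁻¹ =
      r / (2 * a^2 * (r^2 - a^2)) - Real.log ((r + a) / (r - a)) / (4 * a^3) := by
  have hd : ∀ x ∈ Set.Ici r, HasDerivAt (fun x : ℝ => Real.log ((x + a) / (x - a)) / (4 * a^3)
      - x / (2 * a^2 * (x^2 - a^2))) (((x^2 - a^2)^2)⁻¹) x := by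
    intro x hx
    have hx : r ≤ x := hx
    have h1 : 0 < x - a := by linarith
    have h2 : 0 < x + a := by linarith
    have h3 : x^2 - a^2 ≠ 0 := by
      have := mul_pos h1 h2
      nlinarith
    have d1 := ((((hasDerivAt_id x).add_const a).div ((hasDerivAt_id x).sub_const a) h1.ne').log
      (div_pos h2 h1).ne').div_const (4 * a^3)
    have d2 := (hasDerivAt_id x).div ((((hasDerivAt_id x).pow 2).sub_const (a^2)).const_mul (2 * a^2))
      (by simp only [Pi.pow_apply, id]; positivity)
    refine (d1.sub d2).congr_deriv ?_
    have e : x^2 - a^2 = (x - a) * (x + a) := by ring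
    simp only [id, Pi.pow_apply, Pi.div_apply]
    rw [e]
    have := h1.ne'
    have := h2.ne'
    field_simp
    ring
  have hlim : Tendsto (fun x : ℝ => Real.log ((x + a) / (x - a)) / (4 * a^3)
      - x / (2 * a^2 * (x^2 - a^2))) atTop (𝓝 0) := by
    have t1 : Tendsto (fun x : ℝ => (x - a)⁻¹) atTop (𝓝 0) :=
      tendsto_inv_atTop_zero.comp (tendsto_atTop_add_const_right _ (-a) tendsto_id)
    have t2 : Tendsto (fun x : ℝ => (x + a)⁻¹) atTop (𝓝 0) :=
      tendsto_inv_atTop_zero.comp (tendsto_atTop_add_const_right _ a tendsto_id)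
    have t3 : Tendsto (fun x : ℝ => 1 + 2 * a * (x - a)⁻¹) atTop (𝓝 1) := by
      simpa using (t1.const_mul (2 * a)).const_add 1
    have t4 := (((t3.log one_ne_zero).div_const (4 * a^3)).sub ((t1.add t2).div_const (4 * a^2)))
    simp only [Real.log_one, zero_div, add_zero, sub_zero] at t4
    refine t4.congr' ?_
    filter_upwards [eventually_gt_atTop a] with x hx
    have h1 : 0 < x - a := by linarith
    have h2 : 0 < x + a := by linarith
    have e : x^2 - a^2 = (x - a) * (x + a) := by ring
    rw [e]
    have := h1.ne'
    have := h2.ne'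
    congr 1
    · congr 2
      field_simp
      ring
    · field_simp
      ring
  have hn : ∀ x ∈ Set.Ioi r, 0 ≤ ((x^2 - a^2)^2)⁻¹ := fun x _ => by positivity
  refine ⟨integrableOn_Ioi_deriv_of_nonneg' hd hn hlim, ?_⟩
  rw [integral_Ioi_of_hasDerivAt_of_nonneg' hd hn hlim]
  ring

open Filter Topology in
lemma btz_aux2 (a r : ℝ) (ha : 0 < a) (hr : a < r) :
    IntegrableOn (fun x : ℝ => ((x^2 - a^2) * √(x^2 - a^2))⁻¹) (Set.Ioi r) ∧
    ∫ x in Set.Ioi r, ((x^2 - a^2) * √(x^2 - a^2))⁻¹ =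
      r / (a^2 * √(r^2 - a^2)) - 1 / a^2 := by
  have hd : ∀ x ∈ Set.Ici r, HasDerivAt (fun x : ℝ => - (x / (a^2 * √(x^2 - a^2))))
      (((x^2 - a^2) * √(x^2 - a^2))⁻¹) x := by
    intro x hx
    have hx : r ≤ x := hx
    have h3 : 0 < x^2 - a^2 := by nlinarith
    have h4 := Real.sqrt_pos.2 h3
    have h5 := Real.sq_sqrt h3.le
    have d2 := ((hasDerivAt_id x).div (((((hasDerivAt_id x).pow 2).sub_const (a^2)).sqrt
      (by simp only [Pi.pow_apply, id]; positivity)).const_mul (a^2))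
      (by simp only [Pi.pow_apply, id]; positivity)).neg
    refine d2.congr_deriv ?_
    simp only [id, Pi.pow_apply, Pi.div_apply]
    set s := √(x^2 - a^2)
    rw [← h5]
    field_simp
    push_cast
    ring_nf
    linear_combination (-2) * h5
  have hlim : Tendsto (fun x : ℝ => - (x / (a^2 * √(x^2 - a^2)))) atTop (𝓝 (-(1 / a^2))) := by
    have t1 : Tendsto (fun x : ℝ => (x - a)⁻¹) atTop (𝓝 0) :=
      tendsto_inv_atTop_zero.comp (tendsto_atTop_add_const_right _ (-a) tendsto_id)
    have t2 : Tendsto (fun x : ℝ => (x + a)⁻¹) atTop (𝓝 0) :=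
      tendsto_inv_atTop_zero.comp (tendsto_atTop_add_const_right _ a tendsto_id)
    have t3 : Tendsto (fun x : ℝ => 1 + a^2 * ((x - a)⁻¹ * (x + a)⁻¹)) atTop (𝓝 1) := by
      simpa using ((t1.mul t2).const_mul (a^2)).const_add 1
    have t4 := (t3.sqrt.div_const (a^2)).neg
    rw [Real.sqrt_one] at t4
    refine t4.congr' ?_
    filter_upwards [eventually_gt_atTop a] with x hx
    have h1 : 0 < x - a := by linarith
    have h2 : 0 < x + a := by linarith
    have e : x^2 - a^2 = (x - a) * (x + a) := by ring
    have e2 : 1 + a^2 * ((x - a)⁻¹ * (x + a)⁻¹) = x^2 / (x^2 - a^2) := by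
      rw [e]
      have := h1.ne'
      have := h2.ne'
      field_simp
      ring
    rw [e2, Real.sqrt_div (by positivity), Real.sqrt_sq (by linarith), div_div, mul_comm (a^2)]
  have hn : ∀ x ∈ Set.Ioi r, 0 ≤ ((x^2 - a^2) * √(x^2 - a^2))⁻¹ := fun x hx => by
    have hx : r < x := hx
    have h3 : 0 < x^2 - a^2 := by nlinarith
    positivity
  refine ⟨integrableOn_Ioi_deriv_of_nonneg' hd hn hlim, ?_⟩
  rw [integral_Ioi_of_hasDerivAt_of_nonneg' hd hn hlim]
  ring

lemma btz_aux3 (a r : ℝ) (ha : 0 < a) (hr : a < r) :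
    √(r^2 - a^2) * Real.log ((r + a) / (r - a)) < 2 * a := by
  have h1 : 0 < r - a := by linarith
  have h2 : 0 < r + a := by linarith
  have e : r^2 - a^2 = (r + a) * (r - a) := by ring
  set p := √(r + a) with hp
  set q := √(r - a) with hq
  have hp0 : 0 < p := Real.sqrt_pos.2 h2
  have hq0 : 0 < q := Real.sqrt_pos.2 h1
  have hp2 : p^2 = r + a := Real.sq_sqrt h2.le
  have hq2 : q^2 = r - a := Real.sq_sqrt h1.le
  have hpq : q < p := Real.sqrt_lt_sqrt h1.le (by linarith)
  rw [e, Real.sqrt_mul h2.le, ← hp, ← hq, ← hp2, ← hq2, ← div_pow, Real.log_pow]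
  have hl : 0 < Real.log (p / q) := Real.log_pos ((one_lt_div hq0).2 hpq)
  have := Real.self_lt_sinh_iff.2 hl
  rw [Real.sinh_log (by positivity)] at this
  have h6 := mul_lt_mul_of_pos_left this (mul_pos hp0 hq0)
  have h7 : p * q * ((p / q - (p / q)⁻¹) / 2) = (p^2 - q^2) / 2 := by
    field_simp
  rw [h7, hp2, hq2] at h6
  push_cast
  linarith

/-- **Causal wedge recession for the BTZ black hole.** For the blackening
factor `f(x) = x² + 1 − α` with `α > 1` and any `r` greater than the horizon
radius `r₊ = √(α−1)`, the integral
`∫_{r}^{∞} f(r')^{-3/2}·(√(f(r)/f(r')) − 1/2) dr'` is strictly positive; this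
says that the causal wedge of a fixed boundary region recedes in renormalized
geodesic distance as the black hole mass increases. -/
theorem btz_causal_wedge_recession (α : ℝ) (hα : 1 < α) (r : ℝ)
    (hr : Real.sqrt (α - 1) < r) :
    0 < ∫ x in Set.Ioi r,
        (x ^ 2 + 1 - α) ^ (-(3 : ℝ) / 2) *
          (Real.sqrt ((r ^ 2 + 1 - α) / (x ^ 2 + 1 - α)) - 1 / 2) := by
  set a := √(α - 1) with ha'
  have ha : 0 < a := Real.sqrt_pos.2 (by linarith)
  have ha2 : a^2 = α - 1 := Real.sq_sqrt (by linarith)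
  have e : ∀ x : ℝ, x^2 + 1 - α = x^2 - a^2 := fun x => by rw [ha2]; ring
  simp only [e]
  have hs : 0 < r^2 - a^2 := by nlinarith
  have hs' := Real.sqrt_pos.2 hs
  have hs2 := Real.sq_sqrt hs.le
  obtain ⟨i1, v1⟩ := btz_aux1 a r ha hr
  obtain ⟨i2, v2⟩ := btz_aux2 a r ha hr
  have key : ∫ x in Set.Ioi r, (x ^ 2 - a^2) ^ (-(3 : ℝ) / 2) *
          (√((r ^ 2 - a^2) / (x ^ 2 - a^2)) - 1 / 2) =
      ∫ x in Set.Ioi r, (√(r^2 - a^2) * ((x^2 - a^2)^2)⁻¹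
        - 1 / 2 * ((x^2 - a^2) * √(x^2 - a^2))⁻¹) := by
    refine setIntegral_congr_fun measurableSet_Ioi fun x hx => ?_
    have hx : r < x := hx
    have h3 : 0 < x^2 - a^2 := by nlinarith
    have h4 := Real.sqrt_pos.2 h3
    have h5 := Real.sq_sqrt h3.le
    have h6 : (x ^ 2 - a^2) ^ (-(3 : ℝ) / 2) = ((x^2 - a^2) * √(x^2 - a^2))⁻¹ := by
      rw [show (-(3:ℝ)/2) = -(1 + 1/2) by norm_num, Real.rpow_neg h3.le,
        Real.rpow_add h3, Real.rpow_one, ← Real.sqrt_eq_rpow]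
    simp only [h6]
    rw [Real.sqrt_div hs.le]
    set s := √(x^2 - a^2)
    rw [← h5]
    field_simp
  rw [key, integral_sub (i1.const_mul _) (i2.const_mul _), integral_const_mul,
    integral_const_mul, v1, v2]
  have h := btz_aux3 a r ha hr
  set s := √(r^2 - a^2)
  rw [← hs2]
  set L := Real.log ((r + a) / (r - a))
  have : s * (r / (2 * a^2 * s^2) - L / (4 * a^3)) - 1/2 * (r / (a^2 * s) - 1 / a^2)
      = (2 * a - s * L) / (4 * a^3) := by
    field_simp
    ring
  rw [this]
  exact div_pos (by linarith) (by positivity)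
end
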